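/- If the set of social (Pareto) optima Π_SO is nonempty, then the set of Nash equilibria Π_NE is nonempty. -/

import Mathlib

/-- Player `i`'s strategy `si` is feasible against the other players' strategies in
profile `σ`. -/
def FeasibleAgainst {N : ℕ} {S : Fin N → Type*} (Φ : ∀ i, Set (S i))
    (Compat : ∀ i j, S i → S j → Prop) (i : Fin N) (si : S i) (σ : ∀ j, S j) : Prop :=
  si ∈ Φ i ∧ ∀ j, j ≠ i → Compat i j si (σ j)

/-- A profile is jointly feasible if each player's strategy is feasible against the
others'. -/
def JointlyFeasible {N : ℕ} {S : Fin N → Type*} (Φ : ∀ i, Set (S i))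
    (Compat : ∀ i j, S i → S j → Prop) (σ : ∀ j, S j) : Prop :=
  ∀ i, FeasibleAgainst Φ Compat i (σ i) σ

/-- Strict componentwise (Pareto) order on `ℝ^p`. -/
def ParetoLt {p : ℕ} (a b : Fin p → ℝ) : Prop :=
  (∀ ℓ, a ℓ ≤ b ℓ) ∧ a ≠ b

/-- Nash equilibrium: a jointly feasible profile from which no player has a feasible
unilateral deviation with strictly smaller cost. -/
def NashEquilibrium {N p : ℕ} {S : Fin N → Type*} (Φ : ∀ i, Set (S i))
    (Compat : ∀ i j, S i → S j → Prop) (Cost : ∀ i, S i → Fin p → ℝ)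
    (σbar : ∀ j, S j) : Prop :=
  JointlyFeasible Φ Compat σbar ∧
    ∀ i, ¬ ∃ si : S i, FeasibleAgainst Φ Compat i si σbar ∧
      ParetoLt (Cost i si) (Cost i (σbar i))

/-- Social (Pareto) optimum. -/
def SocialOptimum {N p : ℕ} {S : Fin N → Type*} (Φ : ∀ i, Set (S i))
    (Compat : ∀ i j, S i → S j → Prop) (Cost : ∀ i, S i → Fin p → ℝ)
    (σbar : ∀ j, S j) : Prop :=
  JointlyFeasible Φ Compat σbar ∧
    ¬ ∃ σ : ∀ j, S j, JointlyFeasible Φ Compat σ ∧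
      ParetoLt (∑ i, Cost i (σ i)) (∑ i, Cost i (σbar i))

/-- A feasible unilateral deviation from a jointly feasible profile yields a jointly
feasible profile. -/
theorem JointlyFeasible.update {N : ℕ} {S : Fin N → Type*} {Φ : ∀ i, Set (S i)}
    {Compat : ∀ i j, S i → S j → Prop} {σ : ∀ j, S j} (hσ : JointlyFeasible Φ Compat σ)
    (hsym : ∀ i j, i ≠ j → ∀ (si : S i) (sj : S j), Compat i j si sj ↔ Compat j i sj si)
    {i : Fin N} {si : S i} (hsi : FeasibleAgainst Φ Compat i si σ) :
    JointlyFeasible Φ Compat (Function.update σ i si) := by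
  intro k
  rcases eq_or_ne k i with rfl | hk
  · refine ⟨by simpa using hsi.1, fun j hj => ?_⟩
    simpa [Function.update_of_ne hj] using hsi.2 j hj
  · rw [Function.update_of_ne hk]
    refine ⟨(hσ k).1, fun j hj => ?_⟩
    rcases eq_or_ne j i with rfl | hji
    · simpa using (hsym j k hj _ _).1 (hsi.2 k hk)
    · simpa [Function.update_of_ne hji] using (hσ k).2 j hj

/-- Lowering one player's cost lowers the total cost. -/
theorem paretoLt_sum_update {N p : ℕ} {S : Fin N → Type*} (Cost : ∀ i, S i → Fin p → ℝ)
    (σ : ∀ j, S j) {i : Fin N} {si : S i} (h : ParetoLt (Cost i si) (Cost i (σ i))) :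
    ParetoLt (∑ j, Cost j (Function.update σ i si j)) (∑ j, Cost j (σ j)) := by
  have hlt : Cost i si < Cost i (σ i) := lt_of_le_of_ne h.1 h.2
  have hsum : ∑ j, Cost j (Function.update σ i si j) < ∑ j, Cost j (σ j) := by
    refine Finset.sum_lt_sum (fun j _ => ?_) ⟨i, Finset.mem_univ i, by simpa using hlt⟩
    rcases eq_or_ne j i with rfl | hj
    · simpa using hlt.le
    · rw [Function.update_of_ne hj]
  exact ⟨hsum.le, hsum.ne⟩

/-- If the set of social optima is nonempty, so is the set of Nash
equilibria. -/
theorem nashEquilibrium_nonempty_of_socialOptimum_nonempty {N p : ℕ}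
    {S : Fin N → Type*} (hne : ∀ i, Nonempty (S i))
    (Φ : ∀ i, Set (S i)) (Compat : ∀ i j, S i → S j → Prop)
    (hsym : ∀ i j, i ≠ j → ∀ (si : S i) (sj : S j), Compat i j si sj ↔ Compat j i sj si)
    (Cost : ∀ i, S i → Fin p → ℝ) (hCost : ∀ i (si : S i) ℓ, 0 ≤ Cost i si ℓ)
    (hSO : ∃ σbar : ∀ j, S j, SocialOptimum Φ Compat Cost σbar) :
    ∃ σ : ∀ j, S j, NashEquilibrium Φ Compat Cost σ := by
  obtain ⟨σ, hσ, hopt⟩ := hSO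
  refine ⟨σ, hσ, ?_⟩
  rintro i ⟨si, hsi, hlt⟩
  exact hopt ⟨Function.update σ i si, hσ.update hsym hsi,
    paretoLt_sum_update Cost σ hlt⟩
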